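/- Let Φ be a linear map from n×n complex matrices to m×m complex matrices that maps positive semidefinite matrices to positive semidefinite matrices. Let ρ and σ be positive semidefinite n×n matrices and let λ ∈ ℝ be such that ρ ≤ 2^λ σ in the Loewner order. Then Φ(ρ) ≤ 2^λ Φ(σ). Consequently, the max-relative entropy is monotone under Φ: Dmax(Φ(ρ) ‖ Φ(σ)) ≤ Dmax(ρ ‖ σ). -/

import Mathlib

open ComplexOrder

/-- The max-relative entropy `Dmax(ρ ‖ σ) = inf { λ : ρ ≤ 2^λ σ }` (Loewner order),
valued in `EReal` so that the infimum of the empty set is `+∞`. -/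
noncomputable def Dmax {n : ℕ} (ρ σ : Matrix (Fin n) (Fin n) ℂ) : EReal :=
  sInf {e : EReal | ∃ r : ℝ, e = (r : EReal) ∧ (((2 : ℝ) ^ r) • σ - ρ).PosSemidef}

/-- A positivity-preserving linear map `Φ` preserves Loewner inequalities
`ρ ≤ 2^λ σ`, and consequently the max-relative entropy is monotone under `Φ`. -/
theorem dmax_monotone {n m : ℕ}
    (Φ : Matrix (Fin n) (Fin n) ℂ →ₗ[ℂ] Matrix (Fin m) (Fin m) ℂ)
    (hΦ : ∀ M : Matrix (Fin n) (Fin n) ℂ, M.PosSemidef → (Φ M).PosSemidef)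
    (ρ σ : Matrix (Fin n) (Fin n) ℂ) (hρ : ρ.PosSemidef) (hσ : σ.PosSemidef) :
    (∀ l : ℝ, (((2 : ℝ) ^ l) • σ - ρ).PosSemidef →
        (((2 : ℝ) ^ l) • Φ σ - Φ ρ).PosSemidef)
      ∧ Dmax (Φ ρ) (Φ σ) ≤ Dmax ρ σ := by
  have preserves (l : ℝ) (h : (((2 : ℝ) ^ l) • σ - ρ).PosSemidef) :
      (((2 : ℝ) ^ l) • Φ σ - Φ ρ).PosSemidef := by
    rw [← LinearMap.map_smul_of_tower, ← map_sub]
    exact hΦ _ h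
  refine ⟨preserves, sInf_le_sInf ?_⟩
  rintro _ ⟨r, rfl, hr⟩
  exact ⟨r, rfl, preserves r hr⟩
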